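/- For any finite sets E ⊆ F ⊆ ℤ^d and any n ≥ 0, the uIDLA aggregate A_n(F) stochastically dominates DA_{F∖E}(A_n(E; |F|)), the IDLA aggregate obtained by launching one additional particle from each point of F ∖ E onto the subset uIDLA aggregate A_n(E; |F|). -/

import Mathlib

open MeasureTheory Filter
open scoped ENNReal

noncomputable section

/-- The `k`-th binary digit of `x ∈ [0,1)` (after the binary point). -/
def bit (x : ℝ) (k : ℕ) : Bool := ⌊x * 2 ^ (k + 1)⌋ % 2 == 1

/-- From one uniform sample on `[0,1]`, extract countably many independent uniform
samples on `[0,1]`, using disjoint subsequences of binary digits. -/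
def uSlice (x : ℝ) (i : ℕ) : ℝ :=
  ∑' j : ℕ, if bit x (Nat.pair i j) then ((2 : ℝ) ^ (-(j : ℤ) - 1)) else 0

/-- The base probability space: Lebesgue measure restricted to `[0,1]`. -/
def μ0 : Measure ℝ := volume.restrict (Set.Icc 0 1)

/-- The vertex set of the lattice `ℤ^d`. -/
abbrev V (d : ℕ) := Fin d → ℤ

instance (d : ℕ) : MeasurableSpace (Finset (V d)) := ⊤

open Classical in
/-- `B[r]`: the Euclidean ball of radius `r` in `ℤ^d`, as a `Finset`. -/
def ball (d : ℕ) (r : ℝ) : Finset (V d) :=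
  (Finset.Icc (fun _ => -⌈r⌉) (fun _ => ⌈r⌉)).filter
    (fun y => Real.sqrt (∑ i, ((y i : ℝ)) ^ 2) ≤ r)

/-- `b_n`: the number of lattice points in the Euclidean ball of radius `n`. -/
def bn (d n : ℕ) : ℕ := (ball d n).card

/-- The `2d` unit vectors of `ℤ^d` (the possible steps of the simple random walk). -/
def unitVecs (d : ℕ) : Finset (V d) :=
  Finset.image
    (fun p : Fin d × Bool => fun j => if j = p.1 then (if p.2 then 1 else -1) else 0)
    Finset.univ

/-- Given `u` uniform on `[0,1]`, `pick S u` is a uniformly chosen element of `S`. -/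
def pick {d : ℕ} (S : Finset (V d)) (u : ℝ) : V d :=
  if h : S.Nonempty then
    (S.equivFin.symm ⟨(⌊u * S.card⌋).toNat % S.card,
      Nat.mod_lt _ (Finset.card_pos.mpr h)⟩).val
  else 0

/-- Position at time `t` of the simple random walk started at `x`, driven by the
random seed `ω`: the steps `pick (unitVecs d) (uSlice ω i)` are i.i.d. uniform on
the `2d` unit vectors when `ω` is uniform on `[0,1]`. -/
def walk {d : ℕ} (x : V d) (ω : ℝ) (t : ℕ) : V d :=
  x + ∑ i ∈ Finset.range t, pick (unitVecs d) (uSlice ω i)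

/-- `t_S`: the first time the walk started at `x` is outside `S`. -/
def exitT {d : ℕ} (S : Finset (V d)) (x : V d) (ω : ℝ) : ℕ :=
  sInf {t | walk x ω t ∉ S}

/-- The position `ξ(t_S)` at which the walk started at `x` first exits `S`. -/
def hitPt {d : ℕ} (S : Finset (V d)) (x : V d) (ω : ℝ) : V d :=
  walk x ω (exitT S x ω)

/-- `Add[ξ,S]`: add to `S` the exit point of a random walk started at `x`. -/
def addPt {d : ℕ} (S : Finset (V d)) (x : V d) (ω : ℝ) : Finset (V d) :=
  insert (hitPt S x ω) S

/-- `P_x(ξ(τ_A) = y)`: the probability that the walk started at `x` exits `A` at `y`. -/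
def hitProb {d : ℕ} (A : Finset (V d)) (x y : V d) : ℝ≥0∞ :=
  μ0 {ω | hitPt A x ω = y}

/-- The outer boundary `∂A`: vertices outside `A` with a neighbour in `A`. -/
def outb {d : ℕ} (A : Finset (V d)) : Finset (V d) :=
  (A.biUnion fun x => (unitVecs d).image (fun e => x + e)) \ A

/-- `DA_X(S)`: the IDLA aggregate obtained from `S` by launching one particle from each
point of the list `xs` in turn (driven by independent slices of the seed `ω`). -/
def daFrom {d : ℕ} : Finset (V d) → List (V d) → ℝ → Finset (V d)
  | S, [], _ => S
  | S, x :: xs, ω => daFrom (addPt S x (uSlice ω 0)) xs (uSlice ω 1)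

/-- The law of the IDLA aggregate `DA_X(S)`. -/
def daLaw {d : ℕ} (S : Finset (V d)) (xs : List (V d)) : Measure (Finset (V d)) :=
  μ0.map (fun ω => daFrom S xs ω)

/-- One uIDLA step: launch a particle from a uniformly chosen point of `S`. -/
def uStep {d : ℕ} (S : Finset (V d)) (ω : ℝ) : Finset (V d) :=
  addPt S (pick S (uSlice ω 0)) (uSlice ω 1)

/-- `A_k(S)`: the uIDLA aggregate obtained by adding `k` particles to `S`,
each started at a uniform point of the current aggregate. -/
def uAggFrom {d : ℕ} (S : Finset (V d)) (ω : ℝ) : ℕ → Finset (V d)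
  | 0 => S
  | k + 1 => uStep (uAggFrom S ω k) (uSlice ω k)

/-- The law of the uIDLA aggregate `A_k(S)`. -/
def uLaw {d : ℕ} (S : Finset (V d)) (k : ℕ) : Measure (Finset (V d)) :=
  μ0.map (fun ω => uAggFrom S ω k)

/-- One step of the subset uIDLA `A_·(E;m)`: at step `k`, perform a uIDLA step
with probability `|E|/(m+k)` and otherwise do nothing. -/
def subStep {d : ℕ} (m k : ℕ) (E : Finset (V d)) (ω : ℝ) : Finset (V d) :=
  if uSlice ω 0 * ((m : ℝ) + k) ≤ E.card then uStep E (uSlice ω 1) else E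

/-- The subset uIDLA `A_n(E;m)`. -/
def subAggFrom {d : ℕ} (E : Finset (V d)) (m : ℕ) (ω : ℝ) : ℕ → Finset (V d)
  | 0 => E
  | k + 1 => subStep m k (subAggFrom E m ω k) (uSlice ω k)

/-- The law of the subset uIDLA `A_n(E;m)`. -/
def subLaw {d : ℕ} (E : Finset (V d)) (m k : ℕ) : Measure (Finset (V d)) :=
  μ0.map (fun ω => subAggFrom E m ω k)

/-- Stochastic domination of random finite subsets of `ℤ^d`: `μ` dominates `ν` if
there is a coupling under which the sample of `ν` is a.s. contained in that of `μ`. -/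
def StochDom {d : ℕ} (μ ν : Measure (Finset (V d))) : Prop :=
  ∃ π : Measure (Finset (V d) × Finset (V d)), IsProbabilityMeasure π ∧
    π.map Prod.fst = μ ∧ π.map Prod.snd = ν ∧ π {p | p.2 ⊆ p.1} = 1

/-- A `Geometric(1/2)` sample (taking value `j ≥ 0` with probability `2^{-(j+1)}`)
produced from a uniform sample `u` on `[0,1]` by inverting the CDF. -/
def geom (u : ℝ) : ℕ := sInf {j : ℕ | u ≤ 1 - (2 : ℝ) ^ (-(j : ℤ) - 1)}

/-- The parent of vertex `j ≥ 1` in the uniform random recursive tree (vertex `0` is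
the root): uniform on `{0, …, j-1}` when the seed is uniform on `[0,1]`. -/
def parent (ω : ℝ) (j : ℕ) : ℕ := (⌊uSlice ω (Nat.pair 0 j) * j⌋).toNat % j

/-- The reaching time of vertex `j` in a uniform random recursive tree whose edges
carry i.i.d. `Geometric(1/2)` weights: the sum of the weights on the path from the
root to `j`. (The `min` is a.s. inoperative, since a.s. `parent ω (j+1) ≤ j`.) -/
def reach (ω : ℝ) : ℕ → ℕ
  | 0 => 0
  | j + 1 => reach ω (min (parent ω (j + 1)) j) + geom (uSlice ω (Nat.pair 1 (j + 1)))
termination_by j => j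
decreasing_by exact Nat.lt_succ_of_le (min_le_right _ _)

end


instance instProbMu0 : IsProbabilityMeasure μ0 := by
  constructor
  simp [μ0]

theorem floor_succ_bit (x : ℝ) (n : ℕ) :
    ⌊x * 2 ^ (n + 1)⌋ = 2 * ⌊x * 2 ^ n⌋ + (if bit x n then 1 else 0) := by
  have h1 := Int.floor_le (x * 2 ^ n)
  have h2 := Int.lt_floor_add_one (x * 2 ^ n)
  have h3 : 2 * ⌊x * 2 ^ n⌋ ≤ ⌊x * 2 ^ (n + 1)⌋ := by
    rw [Int.le_floor]; push_cast; rw [pow_succ]; linarith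
  have h4 : ⌊x * 2 ^ (n + 1)⌋ < 2 * ⌊x * 2 ^ n⌋ + 2 := by
    rw [Int.floor_lt]; push_cast; rw [pow_succ]; linarith
  unfold bit
  by_cases h : ⌊x * 2 ^ (n + 1)⌋ % 2 = 1
  · simp [h]; omega
  · simp [h]; omega

theorem measurable_bit (k : ℕ) : Measurable (fun x => bit x k) := by
  unfold bit
  have : Measurable (fun x : ℝ => ⌊x * 2 ^ (k + 1)⌋) := by fun_prop
  exact (measurable_of_countable (fun z : ℤ => (z % 2 == 1))).comp this

/-- the real with binary digits `b` -/
noncomputable def ofBits (b : ℕ → Bool) : ℝ :=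
  ∑' j : ℕ, if b j then ((2 : ℝ) ^ (-(j : ℤ) - 1)) else 0

theorem summable_bits (b : ℕ → Bool) :
    Summable (fun j : ℕ => if b j then ((2 : ℝ) ^ (-(j : ℤ) - 1)) else 0) := by
  refine Summable.of_nonneg_of_le (f := fun j : ℕ => (1 / 2 : ℝ) ^ j * (1/2)) ?_ ?_ ?_
  · intro j; split_ifs <;> positivity
  · intro j
    have : (2 : ℝ) ^ (-(j : ℤ) - 1) = (1 / 2 : ℝ) ^ j * (1/2) := by
      rw [zpow_sub₀ (by norm_num), zpow_neg]; simp [div_eq_mul_inv]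
    split_ifs
    · exact this.le
    · positivity
  · exact (summable_geometric_of_lt_one (by norm_num) (by norm_num)).mul_right _

theorem measurable_ofBits : Measurable ofBits := by
  unfold ofBits
  have : Measurable (fun b : ℕ → Bool => ∑' j : ℕ, ENNReal.ofReal (if b j then ((2 : ℝ) ^ (-(j : ℤ) - 1)) else 0)) := by
    refine Measurable.ennreal_tsum fun j => ?_
    refine ENNReal.measurable_ofReal.comp ?_
    exact (measurable_of_countable (fun z : Bool => if z then ((2 : ℝ) ^ (-(j : ℤ) - 1)) else 0)).comp
      (measurable_pi_apply j)
  convert this.ennreal_toReal using 2 with b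
  rw [← ENNReal.ofReal_tsum_of_nonneg _ (summable_bits b), ENNReal.toReal_ofReal]
  · refine tsum_nonneg fun j => ?_
    split_ifs <;> positivity
  · intro j; split_ifs <;> positivity

theorem ofBits_bit (x : ℝ) (h0 : 0 ≤ x) (h1 : x < 1) : ofBits (bit x) = x := by
  have hps : ∀ n : ℕ, ∑ j ∈ Finset.range n, (if bit x j then ((2 : ℝ) ^ (-(j : ℤ) - 1)) else 0)
      = (⌊x * 2 ^ n⌋ : ℝ) / 2 ^ n := by
    intro n
    induction n with
    | zero =>
      have : ⌊x⌋ = 0 := by rw [Int.floor_eq_zero_iff]; exact ⟨h0, h1⟩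
      simp [this]
    | succ n ih =>
      rw [Finset.sum_range_succ, ih, floor_succ_bit]
      have : (2 : ℝ) ^ (-(n : ℤ) - 1) = 1 / 2 ^ (n + 1) := by
        rw [zpow_sub₀ (by norm_num), zpow_neg]; simp [pow_succ]; ring
      rw [this]
      push_cast
      split_ifs
      · rw [pow_succ]; field_simp
      · rw [pow_succ]; field_simp; simp
  have hs : HasSum (fun j : ℕ => if bit x j then ((2 : ℝ) ^ (-(j : ℤ) - 1)) else 0) x := by
    rw [hasSum_iff_tendsto_nat_of_nonneg]
    · simp_rw [hps]
      have hl : Tendsto (fun n : ℕ => x - (1 / 2 : ℝ) ^ n) atTop (nhds x) := by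
        simpa using (tendsto_const_nhds (x := x)).sub
          (tendsto_pow_atTop_nhds_zero_of_lt_one (r := (1/2 : ℝ)) (by norm_num) (by norm_num))
      refine tendsto_of_tendsto_of_tendsto_of_le_of_le hl tendsto_const_nhds ?_ ?_
      · intro n
        have := Int.lt_floor_add_one (x * 2 ^ n)
        simp only
        rw [le_div_iff₀ (by positivity), sub_mul, ← mul_pow]
        norm_num; linarith
      · intro n
        have := Int.floor_le (x * 2 ^ n)
        simp only
        rw [div_le_iff₀ (by positivity)]; exact this
    · intro j; split_ifs <;> positivity
  exact hs.tsum_eq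

theorem cylinder_bits (n : ℕ) (v : ℕ → Bool) :
    ∃ N : ℤ, 0 ≤ N ∧ N < 2 ^ n ∧ ∀ x : ℝ, 0 ≤ x → x < 1 →
      ((∀ k < n, bit x k = v k) ↔ ⌊x * 2 ^ n⌋ = N) := by
  induction n with
  | zero =>
    refine ⟨0, le_rfl, by norm_num, fun x h0 h1 => ?_⟩
    have : ⌊x⌋ = 0 := by rw [Int.floor_eq_zero_iff]; exact ⟨h0, h1⟩
    simp [this]
  | succ n ih =>
    obtain ⟨N, hN0, hN1, h⟩ := ih
    refine ⟨2 * N + (if v n then 1 else 0), by split_ifs <;> omega, ?_, fun x h0 h1 => ?_⟩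
    · rw [pow_succ]; split_ifs <;> omega
    · rw [Nat.forall_lt_succ_right, h x h0 h1, floor_succ_bit]
      cases hb : bit x n <;> cases hv : v n <;> simp <;> omega

theorem mu0_floor (n : ℕ) (N : ℤ) (h0 : 0 ≤ N) (h1 : N < 2 ^ n) :
    μ0 {x | 0 ≤ x ∧ x < 1 ∧ ⌊x * 2 ^ n⌋ = N} = (2⁻¹ : ℝ≥0∞) ^ n := by
  have h1' : (N : ℝ) + 1 ≤ 2 ^ n := by exact_mod_cast h1
  have h0' : (0 : ℝ) ≤ N := by exact_mod_cast h0
  have : {x : ℝ | 0 ≤ x ∧ x < 1 ∧ ⌊x * 2 ^ n⌋ = N} = Set.Ico ((N : ℝ) / 2 ^ n) ((N + 1) / 2 ^ n) := by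
    ext x
    simp only [Set.mem_ofPred_eq, Set.mem_Ico, Int.floor_eq_iff]
    rw [div_le_iff₀ (by positivity), lt_div_iff₀ (by positivity)]
    have hp : (0 : ℝ) < 2 ^ n := by positivity
    constructor
    · tauto
    · rintro ⟨a, b⟩
      refine ⟨?_, ?_, a, b⟩
      · by_contra hx; push Not at hx
        nlinarith
      · by_contra hx; push Not at hx
        nlinarith
  rw [this, μ0, Measure.restrict_apply measurableSet_Ico, Set.inter_eq_left.2, Real.volume_Ico]
  · rw [← sub_div, add_sub_cancel_left, one_div, ENNReal.ofReal_inv_of_pos (by positivity),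
      ENNReal.ofReal_pow (by norm_num), ENNReal.inv_pow]; norm_num
  · intro x hx
    have hp : (0 : ℝ) < 2 ^ n := by positivity
    refine ⟨le_trans (by positivity) hx.1, hx.2.le.trans ?_⟩
    rw [div_le_one hp]; exact h1'

theorem ae_mu0 : ∀ᵐ x ∂μ0, 0 ≤ x ∧ x < 1 := by
  unfold μ0
  have h : ∀ᵐ x : ℝ ∂(volume.restrict (Set.Icc (0:ℝ) 1)), x ≠ 1 := by
    refine ae_restrict_of_ae ?_
    simp [ae_iff]
  filter_upwards [h, ae_restrict_mem measurableSet_Icc] with x h1 h2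
  exact ⟨h2.1, lt_of_le_of_ne h2.2 h1⟩

noncomputable def coinM : Measure Bool := μ0.map (fun x => bit x 0)

instance : IsProbabilityMeasure coinM :=
  Measure.isProbabilityMeasure_map (measurable_bit 0).aemeasurable

theorem mu0_cyl (n : ℕ) (v : ℕ → Bool) : μ0 {x | ∀ k < n, bit x k = v k} = (2⁻¹ : ℝ≥0∞) ^ n := by
  obtain ⟨N, h0, h1, h⟩ := cylinder_bits n v
  rw [← mu0_floor n N h0 h1]
  apply measure_congr
  filter_upwards [ae_mu0] with x hx
  apply propext
  change (∀ k < n, bit x k = v k) ↔ (0 ≤ x ∧ x < 1 ∧ ⌊x * 2 ^ n⌋ = N)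
  rw [h x hx.1 hx.2]; tauto

theorem coinM_singleton (b : Bool) : coinM {b} = 2⁻¹ := by
  rw [coinM, Measure.map_apply (measurable_bit 0) (measurableSet_singleton _)]
  have := mu0_cyl 1 (fun _ => b)
  simp only [Nat.lt_one_iff, forall_eq, pow_one] at this
  exact this

theorem map_bits : μ0.map bit = Measure.infinitePi (fun _ : ℕ => coinM) := by
  have hm : Measurable bit := measurable_pi_iff.2 measurable_bit
  have hmf : ∀ n : ℕ, Measurable (fun x (i : Fin n) => bit x i) := fun n =>
    measurable_pi_iff.2 fun i => measurable_bit i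
  have hfin : ∀ n : ℕ, μ0.map (fun x (i : Fin n) => bit x i) = Measure.pi (fun _ : Fin n => coinM) := by
    intro n
    apply Measure.ext_of_singleton
    intro v
    rw [Measure.map_apply (hmf n) (measurableSet_singleton _),
      Measure.pi_singleton]
    simp only [coinM_singleton, Finset.prod_const, Finset.card_univ, Fintype.card_fin]
    rw [← mu0_cyl n (fun k => if h : k < n then v ⟨k, h⟩ else false)]
    congr 1
    ext x
    simp only [Set.mem_preimage, Set.mem_singleton_iff, funext_iff, Set.mem_ofPred_eq]
    constructor
    · intro h k hk; simpa [hk] using h ⟨k, hk⟩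
    · intro h k; simpa using h k k.2
  apply Measure.eq_infinitePi
  intro s t ht
  obtain ⟨n, hn⟩ : ∃ n, s ⊆ Finset.range n := s.exists_nat_subset_range
  have h1 : bit ⁻¹' (Set.pi s t) = (fun x (i : Fin n) => bit x i) ⁻¹'
      (Set.pi Set.univ (fun i : Fin n => if (i : ℕ) ∈ s then t i else Set.univ)) := by
    ext x
    simp only [Set.mem_preimage, Set.mem_pi, Finset.mem_coe, Set.mem_univ, true_imp_iff]
    constructor
    · intro h i; split_ifs with hi
      · exact h i hi
      · trivial
    · intro h i hi
      have := h ⟨i, Finset.mem_range.1 (hn hi)⟩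
      simpa [hi] using this
  rw [Measure.map_apply hm (MeasurableSet.pi s.countable_toSet fun i _ => ht i), h1,
    ← Measure.map_apply (hmf n)
      (MeasurableSet.univ_pi fun i => by split_ifs; exacts [ht _, MeasurableSet.univ]), hfin, Measure.pi_pi]
  rw [Fin.prod_univ_eq_prod_range (fun i => coinM (if i ∈ s then t i else Set.univ)) n]
  rw [← Finset.prod_subset hn]
  · refine Finset.prod_congr rfl fun i hi => by simp [hi]
  · intro i _ hi; rw [if_neg hi, measure_univ]

theorem uSlice_eq (x : ℝ) (i : ℕ) : uSlice x i = ofBits (fun j => bit x (Nat.pair i j)) := rfl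

theorem measurable_uSlice (i : ℕ) : Measurable (fun x => uSlice x i) := by
  simp_rw [uSlice_eq]
  exact measurable_ofBits.comp (measurable_pi_iff.2 fun j => measurable_bit _)

theorem map_ofBits : (Measure.infinitePi (fun _ : ℕ => coinM)).map ofBits = μ0 := by
  rw [← map_bits, Measure.map_map measurable_ofBits (measurable_pi_iff.2 measurable_bit)]
  conv_rhs => rw [← Measure.map_id (μ := μ0)]
  apply Measure.map_congr
  filter_upwards [ae_mu0] with x hx
  exact ofBits_bit x hx.1 hx.2

/-- The law of an i.i.d. sequence of uniforms. -/
noncomputable def Pinf : Measure (ℕ → ℝ) := Measure.infinitePi (fun _ : ℕ => μ0)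

instance : IsProbabilityMeasure Pinf := by unfold Pinf; infer_instance

theorem map_uSlice : μ0.map uSlice = Pinf := by
  have hm : Measurable bit := measurable_pi_iff.2 measurable_bit
  have h2 := Measure.infinitePi_map_curry (ι := ℕ) (κ := ℕ) (X := Bool) (fun _ _ => coinM)
  have h3 := Measure.infinitePi_map_piCongrLeft (X := fun _ : ℕ × ℕ => Bool) (fun _ => coinM) (Nat.pairEquiv.symm)
  have h4 := Measure.infinitePi_map_pi (X := fun _ : ℕ => ℕ → Bool) (Y := fun _ : ℕ => ℝ)
    (fun _ : ℕ => Measure.infinitePi (fun _ : ℕ => coinM)) (f := fun _ => ofBits)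
    (fun _ => measurable_ofBits)
  simp only [map_ofBits] at h4
  rw [Pinf, ← h4, ← h2, ← h3, ← map_bits]
  rw [Measure.map_map (MeasurableEquiv.measurable _) hm,
    Measure.map_map (MeasurableEquiv.measurable _) ((MeasurableEquiv.measurable _).comp hm),
    Measure.map_map]
  · congr 1
    funext x i
    simp only [uSlice_eq, Function.comp]
    congr 1
    funext j
    symm
    change (Equiv.piCongrLeft (fun _ => Bool) Nat.pairEquiv.symm) (bit x) (i, j) = _
    have := Equiv.piCongrLeft_apply_apply (fun _ : ℕ × ℕ => Bool) Nat.pairEquiv.symm (bit x) (Nat.pair i j)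
    simpa using this
  · exact measurable_pi_iff.2 fun i => measurable_ofBits.comp (measurable_pi_apply i)
  · exact (MeasurableEquiv.measurable _).comp ((MeasurableEquiv.measurable _).comp hm)

theorem Pinf_uncons : Pinf.map (fun u => (u 0, fun i => u (i + 1))) = μ0.prod Pinf := by
  have hc : Measurable (fun p : ℝ × (ℕ → ℝ) => (fun i => Nat.casesOn i p.1 p.2 : ℕ → ℝ)) := by
    refine measurable_pi_iff.2 fun i => ?_
    cases i with
    | zero => exact measurable_fst
    | succ i => exact (measurable_pi_apply i).comp measurable_snd
  have hu : Measurable (fun u : ℕ → ℝ => (u 0, fun i => u (i + 1))) := by fun_prop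
  have key : (μ0.prod Pinf).map (fun p : ℝ × (ℕ → ℝ) => (fun i => Nat.casesOn i p.1 p.2 : ℕ → ℝ))
      = Pinf := by
    apply Measure.eq_infinitePi
    intro s t ht
    rw [Measure.map_apply hc (MeasurableSet.pi s.countable_toSet fun i _ => ht i)]
    obtain ⟨n, hn⟩ : ∃ n, s ⊆ Finset.range n := s.exists_nat_subset_range
    have h1 : (fun p : ℝ × (ℕ → ℝ) => (fun i => Nat.casesOn i p.1 p.2 : ℕ → ℝ)) ⁻¹' (Set.pi s t)
        = (if 0 ∈ s then t 0 else Set.univ) ×ˢ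
          (Set.pi (Finset.range n) (fun i => if i + 1 ∈ s then t (i+1) else Set.univ)) := by
      ext p
      simp only [Set.mem_preimage, Set.mem_pi, Finset.mem_coe, Set.mem_prod]
      constructor
      · intro h
        constructor
        · split_ifs with h0
          · exact h 0 h0
          · trivial
        · intro i _
          split_ifs with hi
          · exact h _ hi
          · trivial
      · rintro ⟨ha, hb⟩ i hi
        cases i with
        | zero => simpa [hi] using ha
        | succ i =>
          have := hb i (Finset.mem_range.2 (by have := Finset.mem_range.1 (hn hi); omega))
          simpa [hi] using this
    rw [h1, Measure.prod_prod, Pinf, Measure.infinitePi_pi]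
    · have h2 : s ⊆ Finset.range (n + 1) := hn.trans (Finset.range_subset_range.2 (by omega))
      have h3 : ∏ i ∈ s, μ0 (t i) = ∏ i ∈ Finset.range (n + 1), μ0 (if i ∈ s then t i else Set.univ) := by
        rw [← Finset.prod_subset h2]
        · refine Finset.prod_congr rfl fun i hi => by simp [hi]
        · intro i _ hi; simp [hi]
      rw [h3, Finset.prod_range_succ', mul_comm]
    · intro i _; split_ifs; exacts [ht _, MeasurableSet.univ]
  conv_lhs => rw [← key]
  rw [Measure.map_map hu hc]
  exact Measure.map_id

instance (d : ℕ) : DiscreteMeasurableSpace (Finset (V d)) := ⟨fun _ => trivial⟩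

section lw
variable {Ω : Type*} [MeasurableSpace Ω] {α : Type*} [Countable α] [MeasurableSpace α]
  [MeasurableSingletonClass α] {β : Type*} [Countable β] [MeasurableSpace β]
  [MeasurableSingletonClass β]

/-- The law, as a `PMF`, of a measurable function with countably many values. -/
noncomputable def lw (μ : Measure Ω) [IsProbabilityMeasure μ] (f : Ω → β) (hf : Measurable f) :
    PMF β :=
  haveI := Measure.isProbabilityMeasure_map (μ := μ) hf.aemeasurable
  (μ.map f).toPMF

theorem lw_toMeasure (μ : Measure Ω) [IsProbabilityMeasure μ] (f : Ω → β) (hf : Measurable f) :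
    (lw μ f hf).toMeasure = μ.map f := by
  haveI := Measure.isProbabilityMeasure_map (μ := μ) hf.aemeasurable
  exact Measure.toPMF_toMeasure _

theorem lw_apply (μ : Measure Ω) [IsProbabilityMeasure μ] (f : Ω → β) (hf : Measurable f) (b : β) :
    lw μ f hf b = μ {u | f u = b} := by
  haveI := Measure.isProbabilityMeasure_map (μ := μ) hf.aemeasurable
  change (μ.map f) {b} = _
  rw [Measure.map_apply hf (measurableSet_singleton _)]
  rfl

theorem lw_congr (μ : Measure Ω) [IsProbabilityMeasure μ] (f g : Ω → β) (hf : Measurable f)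
    (hg : Measurable g) (h : f =ᵐ[μ] g) : lw μ f hf = lw μ g hg := by
  ext b
  rw [lw_apply, lw_apply]
  apply measure_congr
  filter_upwards [h] with u hu
  apply propext
  change f u = b ↔ g u = b
  rw [hu]

theorem lw_const (μ : Measure Ω) [IsProbabilityMeasure μ] (f : Ω → β) (hf : Measurable f) (b : β)
    (h : ∀ᵐ u ∂μ, f u = b) : lw μ f hf = PMF.pure b := by
  ext c
  rw [lw_apply, PMF.pure_apply]
  split_ifs with hc
  · subst hc
    exact (mem_ae_iff_prob_eq_one (hf (measurableSet_singleton c))).1 h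
  · apply measure_mono_null _ h
    intro u hu hu'
    exact hc (hu.symm.trans hu')

theorem lw_comp {γ : Type*} [MeasurableSpace γ] (μ : Measure Ω) [IsProbabilityMeasure μ]
    (ν : Measure γ) [IsProbabilityMeasure ν] (g : Ω → γ) (hg : Measurable g) (hν : μ.map g = ν)
    (f : γ → β) (hf : Measurable f) :
    lw μ (fun u => f (g u)) (hf.comp hg) = lw ν f hf := by
  ext b
  rw [lw_apply, lw_apply, ← hν]
  exact (Measure.map_apply hg (hf (measurableSet_singleton b))).symm

theorem lw_map (μ : Measure Ω) [IsProbabilityMeasure μ] (f : Ω → α) (hf : Measurable f)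
    (g : α → β) :
    (lw μ f hf).map g = lw μ (fun u => g (f u)) ((measurable_of_countable g).comp hf) := by
  rw [← PMF.toMeasure_inj, ← PMF.toMeasure_map _ _ (measurable_of_countable g), lw_toMeasure,
    lw_toMeasure, Measure.map_map (measurable_of_countable g) hf]
  rfl

theorem measurable_comb {Ω' : Type*} [MeasurableSpace Ω'] (f : Ω → α) (hf : Measurable f)
    (h : Ω → Ω') (hh : Measurable h)
    (g : α → Ω' → β) (hg : ∀ a, Measurable (g a)) : Measurable (fun u => g (f u) (h u)) := by
  have : Measurable (Function.uncurry g) := measurable_from_prod_countable_right hg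
  exact this.comp (hf.prodMk hh)

theorem lw_prod {Ω' : Type*} [MeasurableSpace Ω'] (μ : Measure Ω) [IsProbabilityMeasure μ]
    (ν : Measure Ω') [IsProbabilityMeasure ν] (f : Ω → α) (hf : Measurable f)
    (g : α → Ω' → β) (hg : ∀ a, Measurable (g a)) :
    lw (μ.prod ν) (fun p => g (f p.1) p.2)
      (measurable_comb _ (hf.comp measurable_fst) _ measurable_snd g hg)
      = (lw μ f hf).bind (fun a => lw ν (g a) (hg a)) := by
  ext b
  have hm : Measurable (fun p : Ω × Ω' => g (f p.1) p.2) := measurable_comb _ (hf.comp measurable_fst) _ (measurable_snd (α := Ω) (β := Ω')) g hg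
  rw [lw_apply]
  have e : {u : Ω × Ω' | g (f u.1) u.2 = b} = (fun p : Ω × Ω' => g (f p.1) p.2) ⁻¹' {b} := rfl
  rw [e, Measure.prod_apply (hm (measurableSet_singleton b)), PMF.bind_apply]
  have : ∀ x, ν (Prod.mk x ⁻¹' ((fun p : Ω × Ω' => g (f p.1) p.2) ⁻¹' {b}))
      = (fun a => lw ν (g a) (hg a) b) (f x) := by
    intro x
    simp only
    rw [lw_apply]; rfl
  simp_rw [this]
  rw [← lintegral_map (f := fun a => lw ν (g a) (hg a) b) (measurable_of_countable _) hf,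
    lintegral_countable']
  refine tsum_congr fun a => ?_
  rw [mul_comm]
  congr 1

end lw

theorem measurable_shift : Measurable (fun (u : ℕ → ℝ) (i : ℕ) => u (i + 1)) := by fun_prop

section lw2
variable {α : Type*} [Countable α] [MeasurableSpace α]
  [MeasurableSingletonClass α] {β : Type*} [Countable β] [MeasurableSpace β]
  [MeasurableSingletonClass β]

theorem lw_uncons (f : ℝ → α) (hf : Measurable f) (g : α → (ℕ → ℝ) → β)
    (hg : ∀ a, Measurable (g a)) (hm : Measurable (fun u : ℕ → ℝ => g (f (u 0)) (fun i => u (i + 1)))) :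
    lw Pinf (fun u => g (f (u 0)) (fun i => u (i + 1))) hm
      = (lw μ0 f hf).bind (fun a => lw Pinf (g a) (hg a)) := by
  rw [← lw_prod]
  exact lw_comp Pinf (μ0.prod Pinf) (fun u => (u 0, fun i => u (i + 1))) (by fun_prop) Pinf_uncons
    (fun p => g (f p.1) p.2) _

theorem lw_eval (i : ℕ) (f : ℝ → α) (hf : Measurable f) (hm : Measurable (fun u : ℕ → ℝ => f (u i))) :
    lw Pinf (fun u => f (u i)) hm = lw μ0 f hf :=
  lw_comp Pinf μ0 (fun u => u i) (measurable_pi_apply i) (Measure.infinitePi_map_eval _ i) f hf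

theorem measurable_uSlice' : Measurable uSlice := measurable_pi_iff.2 measurable_uSlice

theorem lw_slice (f : (ℕ → ℝ) → α) (hf : Measurable f) (hm : Measurable (fun ω => f (uSlice ω))) :
    lw μ0 (fun ω => f (uSlice ω)) hm = lw Pinf f hf :=
  lw_comp μ0 Pinf uSlice measurable_uSlice' map_uSlice f hf

theorem lw_two (f : ℝ → α) (hf : Measurable f) (g : α → ℝ → β)
    (hg : ∀ a, Measurable (g a)) (hm : Measurable (fun ω : ℝ => g (f (uSlice ω 0)) (uSlice ω 1))) :
    lw μ0 (fun ω => g (f (uSlice ω 0)) (uSlice ω 1)) hm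
      = (lw μ0 f hf).bind (fun a => lw μ0 (g a) (hg a)) := by
  rw [lw_slice (fun u => g (f (u 0)) (u 1))
    (measurable_comb (fun u : ℕ → ℝ => f (u 0)) (hf.comp (measurable_pi_apply 0)) _ (measurable_pi_apply 1) g hg)]
  rw [lw_uncons f hf (fun a u => g a (u 0)) (fun a => (hg a).comp (measurable_pi_apply 0))]
  congr 1; funext a
  exact lw_eval 0 (g a) (hg a) _

end lw2

/-! ### picking -/

theorem mu0_floor' (c : ℕ) (N : ℕ) (h1 : N < c) :
    μ0 {x | 0 ≤ x ∧ x < 1 ∧ ⌊x * c⌋ = (N : ℤ)} = (c : ℝ≥0∞)⁻¹ := by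
  have h1' : (N : ℝ) + 1 ≤ c := by exact_mod_cast h1
  have h0' : (0 : ℝ) ≤ N := by positivity
  have hp : (0 : ℝ) < c := by linarith
  have : {x : ℝ | 0 ≤ x ∧ x < 1 ∧ ⌊x * c⌋ = (N : ℤ)} = Set.Ico ((N : ℝ) / c) ((N + 1) / c) := by
    ext x
    simp only [Set.mem_ofPred_eq, Set.mem_Ico, Int.floor_eq_iff]
    rw [div_le_iff₀ (by positivity), lt_div_iff₀ (by positivity)]
    push_cast
    constructor
    · tauto
    · rintro ⟨a, b⟩
      refine ⟨?_, ?_, a, b⟩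
      · by_contra hx; push Not at hx
        nlinarith
      · by_contra hx; push Not at hx
        nlinarith
  rw [this, μ0, Measure.restrict_apply measurableSet_Ico, Set.inter_eq_left.2, Real.volume_Ico]
  · rw [← sub_div, add_sub_cancel_left, one_div, ENNReal.ofReal_inv_of_pos (by positivity)]
    simp
  · intro x hx
    refine ⟨le_trans (by positivity) hx.1, hx.2.le.trans ?_⟩
    rw [div_le_one hp]; exact h1'

theorem measurable_pick {d : ℕ} (S : Finset (V d)) : Measurable (pick S) := by
  by_cases h : S.Nonempty
  · have : pick S = (fun z : ℤ => ((S.equivFin.symm ⟨z.toNat % S.card,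
      Nat.mod_lt _ (Finset.card_pos.mpr h)⟩).val : V d)) ∘ (fun u : ℝ => ⌊u * S.card⌋) := by
      funext u; simp [pick, h]
    rw [this]
    refine (measurable_of_countable _).comp ?_
    fun_prop
  · have : pick S = fun _ => 0 := by funext u; simp [pick, h]
    rw [this]; exact measurable_const

noncomputable def pickP {d : ℕ} (S : Finset (V d)) : PMF (V d) := lw μ0 (pick S) (measurable_pick S)

theorem pickP_empty {d : ℕ} : pickP (∅ : Finset (V d)) = PMF.pure 0 := by
  apply lw_const
  refine Eventually.of_forall fun u => ?_
  simp [pick]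

theorem pickP_apply {d : ℕ} (S : Finset (V d)) (x : V d) (hx : x ∈ S) :
    pickP S x = (S.card : ℝ≥0∞)⁻¹ := by
  have hne : S.Nonempty := ⟨x, hx⟩
  have hc : 0 < S.card := Finset.card_pos.2 hne
  rw [pickP, lw_apply, ← mu0_floor' S.card (S.equivFin ⟨x, hx⟩) (Fin.is_lt _)]
  apply measure_congr
  filter_upwards [ae_mu0] with u hu
  apply propext
  change pick S u = x ↔ (0 ≤ u ∧ u < 1 ∧ ⌊u * S.card⌋ = _)
  have hcr : (0 : ℝ) < S.card := by exact_mod_cast hc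
  have a1 : 0 ≤ ⌊u * S.card⌋ := Int.floor_nonneg.2 (by have := hu.1; positivity)
  have a2 : ⌊u * S.card⌋ < S.card := by
    rw [Int.floor_lt]; push_cast; nlinarith [hu.2]
  have hmod : ⌊u * S.card⌋.toNat % S.card = ⌊u * S.card⌋.toNat := Nat.mod_eq_of_lt (by omega)
  simp only [pick, hne, dif_pos, hu.1, hu.2, true_and]
  have : ∀ (k : Fin S.card), ((S.equivFin.symm k).val = x ↔ k = S.equivFin ⟨x, hx⟩) := by
    intro k
    rw [← Equiv.symm_apply_eq]
    simp [Subtype.ext_iff, eq_comm]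
  rw [this, Fin.ext_iff]
  simp only [hmod]
  omega

theorem pickP_apply_not {d : ℕ} (S : Finset (V d)) (hne : S.Nonempty) (x : V d) (hx : x ∉ S) :
    pickP S x = 0 := by
  rw [pickP, lw_apply]
  convert measure_empty (μ := μ0)
  ext u
  simp only [pick, hne, dif_pos, Set.mem_ofPred_eq, Set.mem_empty_iff_false, iff_false]
  intro h
  exact hx (h ▸ Subtype.prop _)

/-! ### the walk as a function of a sequence -/

noncomputable def sw {d : ℕ} (x : V d) (u : ℕ → ℝ) (t : ℕ) : V d :=
  x + ∑ i ∈ Finset.range t, pick (unitVecs d) (u i)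

noncomputable def sT {d : ℕ} (S : Finset (V d)) (x : V d) (u : ℕ → ℝ) : ℕ :=
  sInf {t | sw x u t ∉ S}

noncomputable def seqHit {d : ℕ} (S : Finset (V d)) (x : V d) (u : ℕ → ℝ) : V d :=
  sw x u (sT S x u)

theorem hitPt_eq {d : ℕ} (S : Finset (V d)) (x : V d) (ω : ℝ) : hitPt S x ω = seqHit S x (uSlice ω) := rfl

theorem measurable_sw {d : ℕ} (x : V d) (t : ℕ) : Measurable (fun u => sw x u t) := by
  unfold sw
  refine Measurable.add measurable_const ?_
  exact Finset.measurable_fun_sum _ fun i _ => (measurable_pick _).comp (measurable_pi_apply i)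

theorem measurableSet_sw {d : ℕ} (S : Finset (V d)) (x : V d) (t : ℕ) :
    MeasurableSet {u | sw x u t ∈ S} :=
  measurable_sw x t (Finset.measurableSet S)

theorem measurableSet_stay {d : ℕ} (S : Finset (V d)) (x : V d) :
    MeasurableSet {u | ∀ t, sw x u t ∈ S} := by
  have : {u | ∀ t, sw x u t ∈ S} = ⋂ t, {u | sw x u t ∈ S} := by ext; simp
  rw [this]
  exact MeasurableSet.iInter fun t => measurableSet_sw S x t

theorem sT_eq_iff {d : ℕ} (S : Finset (V d)) (x : V d) (u : ℕ → ℝ) (k : ℕ) :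
    sT S x u = k ↔ (sw x u k ∉ S ∧ ∀ j < k, sw x u j ∈ S) ∨ (k = 0 ∧ ∀ t, sw x u t ∈ S) := by
  by_cases h : ∀ t, sw x u t ∈ S
  · have : {t | sw x u t ∉ S} = ∅ := by ext t; simp [h t]
    simp [sT, this, h, eq_comm]
  · push Not at h
    have hne : {t | sw x u t ∉ S}.Nonempty := h
    have hm := Nat.sInf_mem hne
    have hl : ∀ j < sInf {t | sw x u t ∉ S}, sw x u j ∈ S := fun j hj => by
      have := Nat.notMem_of_lt_sInf hj
      simpa using this
    constructor
    · rintro rfl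
      exact Or.inl ⟨hm, hl⟩
    · rintro (⟨h1, h2⟩ | ⟨h1, h2⟩)
      · apply le_antisymm
        · exact Nat.sInf_le h1
        · by_contra hlt
          push Not at hlt
          exact hm (h2 _ hlt)
      · obtain ⟨t, ht⟩ := h
        exact absurd (h2 t) ht

theorem measurable_sT {d : ℕ} (S : Finset (V d)) (x : V d) : Measurable (sT S x) := by
  apply measurable_to_countable'
  intro k
  have : sT S x ⁻¹' {k} = ({u | sw x u k ∈ S}ᶜ ∩ ⋂ j : Fin k, {u | sw x u j ∈ S}) ∪
      ({u | k = 0} ∩ {u | ∀ t, sw x u t ∈ S}) := by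
    ext u
    simp only [Set.mem_preimage, Set.mem_singleton_iff, sT_eq_iff]
    simp [Fin.forall_iff]
  rw [this]
  refine (((measurableSet_sw S x k).compl).inter (MeasurableSet.iInter fun j : Fin k => measurableSet_sw S x j)).union
    ((MeasurableSet.const _).inter (measurableSet_stay S x))

theorem measurable_seqHit {d : ℕ} (S : Finset (V d)) (x : V d) : Measurable (seqHit S x) :=
  measurable_comb (sT S x) (measurable_sT S x) id measurable_id (fun t u => sw x u t) (measurable_sw x)

theorem sw_zero {d : ℕ} (x : V d) (u : ℕ → ℝ) : sw x u 0 = x := by simp [sw]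

theorem sw_succ {d : ℕ} (x : V d) (u : ℕ → ℝ) (t : ℕ) :
    sw x u (t + 1) = sw (x + pick (unitVecs d) (u 0)) (fun i => u (i + 1)) t := by
  simp only [sw]
  rw [Finset.sum_range_succ']
  abel

theorem seqHit_of_notMem {d : ℕ} (S : Finset (V d)) (x : V d) (u : ℕ → ℝ) (hx : x ∉ S) :
    seqHit S x u = x := by
  have : sT S x u = 0 := by
    rw [sT_eq_iff]; left; simp [sw_zero, hx]
  rw [seqHit, this, sw_zero]

theorem seqHit_step {d : ℕ} (S : Finset (V d)) (x : V d) (u : ℕ → ℝ) (hx : x ∈ S)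
    (h : ¬ ∀ t, sw x u t ∈ S) :
    seqHit S x u = seqHit S (x + pick (unitVecs d) (u 0)) (fun i => u (i + 1)) := by
  have : sT S x u = sT S (x + pick (unitVecs d) (u 0)) (fun i => u (i + 1)) + 1 := by
    rw [sT_eq_iff]; left
    rcases (sT_eq_iff S (x + pick (unitVecs d) (u 0)) (fun i => u (i + 1)) _).1 rfl with ⟨h1, h2⟩ | ⟨h1, h2⟩
    · rw [sw_succ]
      refine ⟨h1, fun j hj => ?_⟩
      cases j with
      | zero => rw [sw_zero]; exact hx
      | succ j => rw [sw_succ]; exact h2 j (by omega)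
    · exfalso
      apply h
      intro t
      cases t with
      | zero => rw [sw_zero]; exact hx
      | succ t => rw [sw_succ]; exact h2 t
  rw [seqHit, this, sw_succ]; rfl

theorem seqHit_stay {d : ℕ} (S : Finset (V d)) (x : V d) (u : ℕ → ℝ) 
    (h : ¬ ∀ t, sw x u t ∈ S) : seqHit S x u ∉ S := by
  rcases (sT_eq_iff S x u _).1 rfl with ⟨h1, h2⟩ | ⟨h1, h2⟩
  · exact h1
  · exact absurd h2 h

noncomputable def stepP (d : ℕ) : PMF (V d) := pickP (unitVecs d)

def e0 (d : ℕ) (hd : 0 < d) : V d := fun j => if j = ⟨0, hd⟩ then 1 else 0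

theorem e0_mem (d : ℕ) (hd : 0 < d) : e0 d hd ∈ unitVecs d := by
  simp only [unitVecs, Finset.mem_image, Finset.mem_univ, true_and]
  exact ⟨(⟨0, hd⟩, true), by unfold e0; simp⟩

theorem stepP_e0 (d : ℕ) (hd : 0 < d) : stepP d (e0 d hd) ≠ 0 := by
  rw [stepP, pickP_apply _ _ (e0_mem d hd)]
  simp

theorem max_principle {d : ℕ} (hd : 0 < d) (S : Finset (V d)) (p : PMF (V d)) (hp : p (e0 d hd) ≠ 0)
    (h : V d → ℝ) (hb : ∀ x, |h x| ≤ 1) (h0 : ∀ x ∉ S, h x = 0)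
    (hh : ∀ x ∈ S, h x = ∑' e, (p e).toReal * h (x + e)) (x : V d) : h x ≤ 0 := by
  by_contra hx
  push Not at hx
  have hxS : x ∈ S := by by_contra hn; rw [h0 x hn] at hx; exact lt_irrefl _ hx
  obtain ⟨y, hyS, hy⟩ := S.exists_max_image h ⟨x, hxS⟩
  have hM : 0 < h y := lt_of_lt_of_le hx (hy x hxS)
  have hle : ∀ z, h z ≤ h y := fun z => by
    by_cases hz : z ∈ S
    · exact hy z hz
    · rw [h0 z hz]; exact hM.le
  let S' := S.filter (fun z => h z = h y)
  obtain ⟨z, hzS, hz⟩ := S'.exists_max_image (fun z => z ⟨0, hd⟩) ⟨y, by simp [S', hyS]⟩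
  rw [Finset.mem_filter] at hzS
  have hlt : h (z + e0 d hd) < h y := by
    refine lt_of_le_of_ne (hle _) fun heq => ?_
    have hm : z + e0 d hd ∈ S' := by
      rw [Finset.mem_filter]
      refine ⟨?_, heq⟩
      by_contra hn
      rw [h0 _ hn] at heq
      linarith
    have := hz _ hm
    simp [e0] at this
  have hsum : Summable (fun e => (p e).toReal) := ENNReal.summable_toReal p.tsum_coe_ne_top
  have h1 : ∑' e, (p e).toReal = 1 := by
    rw [← ENNReal.tsum_toReal_eq (fun e => p.apply_ne_top e), p.tsum_coe]; rfl
  have hs2 : Summable (fun e => (p e).toReal * h (z + e)) := by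
    refine Summable.of_norm_bounded hsum fun e => ?_
    rw [Real.norm_eq_abs, abs_mul, abs_of_nonneg ENNReal.toReal_nonneg]
    exact mul_le_of_le_one_right ENNReal.toReal_nonneg (hb _)
  have hs3 : Summable (fun e => (p e).toReal * h y) := hsum.mul_right _
  have := hs2.tsum_lt_tsum (i := e0 d hd) (g := fun e => (p e).toReal * h y)
    (fun e => mul_le_mul_of_nonneg_left (hle _) ENNReal.toReal_nonneg)
    (mul_lt_mul_of_pos_left hlt (ENNReal.toReal_pos hp (p.apply_ne_top _))) hs3
  rw [← hh z hzS.1, tsum_mul_right, h1, hzS.2] at this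
  linarith

theorem harmonic_unique {d : ℕ} (hd : 0 < d) (S : Finset (V d)) (p : PMF (V d))
    (hp : p (e0 d hd) ≠ 0)
    (f g : V d → ℝ≥0∞) (hf1 : ∀ x, f x ≤ 1) (hg1 : ∀ x, g x ≤ 1) (h0 : ∀ x ∉ S, f x = g x)
    (hf : ∀ x ∈ S, f x = ∑' e, p e * f (x + e))
    (hg : ∀ x ∈ S, g x = ∑' e, p e * g (x + e)) (x : V d) : f x = g x := by
  have aux : ∀ (f : V d → ℝ≥0∞), (∀ x, f x ≤ 1) → ∀ x,
      (∑' e, p e * f (x + e)).toReal = ∑' e, (p e).toReal * (f (x + e)).toReal ∧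
      Summable (fun e => (p e).toReal * (f (x + e)).toReal) := by
    intro f hf1 x
    have hne : ∀ e, p e * f (x + e) ≠ ∞ := fun e =>
      ENNReal.mul_ne_top (p.apply_ne_top _) (ne_top_of_le_ne_top ENNReal.one_ne_top (hf1 _))
    constructor
    · rw [ENNReal.tsum_toReal_eq hne]
      simp
    · have := ENNReal.summable_toReal (f := fun e => p e * f (x + e)) (by
        refine ne_top_of_le_ne_top p.tsum_coe_ne_top (ENNReal.tsum_le_tsum fun e => ?_)
        exact mul_le_of_le_one_right' (hf1 _))
      simpa using this
  have key : ∀ (f g : V d → ℝ≥0∞), (∀ x, f x ≤ 1) → (∀ x, g x ≤ 1) → (∀ x ∉ S, f x = g x) →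
      (∀ x ∈ S, f x = ∑' e, p e * f (x + e)) → (∀ x ∈ S, g x = ∑' e, p e * g (x + e)) →
      ∀ x, f x ≤ g x := by
    intro f g hf1 hg1 h0 hf hg x
    have t1 : ∀ (f : V d → ℝ≥0∞), (∀ x, f x ≤ 1) → ∀ x, (f x).toReal ≤ 1 := fun f hf x =>
      ENNReal.toReal_le_of_le_ofReal zero_le_one (by simpa using hf x)
    have := max_principle hd S p hp (fun x => (f x).toReal - (g x).toReal) ?_ ?_ ?_ x
    · rw [← ENNReal.toReal_le_toReal (ne_top_of_le_ne_top ENNReal.one_ne_top (hf1 _))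
        (ne_top_of_le_ne_top ENNReal.one_ne_top (hg1 _))]
      simpa using this
    · intro x
      rw [abs_le]
      have a1 := t1 f hf1 x
      have a2 := t1 g hg1 x
      have a3 : 0 ≤ (f x).toReal := ENNReal.toReal_nonneg
      have a4 : 0 ≤ (g x).toReal := ENNReal.toReal_nonneg
      constructor <;> linarith
    · intro x hx; simp [h0 x hx]
    · intro x hx
      conv_lhs => rw [hf x hx, hg x hx]
      rw [(aux f hf1 x).1, (aux g hg1 x).1, ← (aux f hf1 x).2.tsum_sub (aux g hg1 x).2]
      simp_rw [mul_sub]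
  exact le_antisymm (key f g hf1 hg1 h0 hf hg x)
    (key g f hg1 hf1 (fun x hx => (h0 x hx).symm) hg hf x)

theorem stay_step {d : ℕ} (S : Finset (V d)) (x : V d) (hx : x ∈ S) :
    Pinf {u | ∀ t, sw x u t ∈ S} = ∑' e, stepP d e * Pinf {u | ∀ t, sw (x + e) u t ∈ S} := by
  classical
  have hm : ∀ x, Measurable (fun u => decide (∀ t, sw x u t ∈ S)) := fun x => by
    apply measurable_to_bool
    convert measurableSet_stay S x
    ext u; simp
  have h := lw_uncons (pick (unitVecs d)) (measurable_pick _)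
    (fun e u => decide (∀ t, sw (x + e) u t ∈ S)) (fun e => hm _)
    (measurable_comb (fun u : ℕ → ℝ => pick (unitVecs d) (u 0))
      ((measurable_pick _).comp (measurable_pi_apply 0)) _ measurable_shift _ (fun e => hm _))
  have h2 := congrArg (fun p : PMF Bool => p true) h
  simp only [PMF.bind_apply, lw_apply, decide_eq_true_eq] at h2
  have h3 : {u | ∀ t, sw x u t ∈ S} = {u : ℕ → ℝ | ∀ t, sw (x + pick (unitVecs d) (u 0)) (fun i => u (i + 1)) t ∈ S} := by
    ext u
    simp only [Set.mem_ofPred_eq, ← sw_succ]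
    constructor
    · intro h t; exact h _
    · intro h t
      cases t with
      | zero => rwa [sw_zero]
      | succ t => exact h t
  rw [h3, h2]
  refine tsum_congr fun e => ?_
  rw [stepP, pickP, lw_apply]

theorem stay_zero {d : ℕ} (hd : 0 < d) (S : Finset (V d)) (x : V d) :
    Pinf {u | ∀ t, sw x u t ∈ S} = 0 := by
  refine harmonic_unique hd S (stepP d) (stepP_e0 d hd) (fun x => Pinf {u | ∀ t, sw x u t ∈ S})
    (fun _ => 0) (fun x => prob_le_one) (by simp) ?_ ?_ ?_ x
  · intro x hx
    convert measure_empty (μ := Pinf)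
    ext u
    simp only [Set.mem_ofPred_eq, Set.mem_empty_iff_false, iff_false]
    intro h
    apply hx
    simpa [sw_zero] using h 0
  · intro x hx; exact stay_step S x hx
  · intro x hx; simp

/-- The exit law. -/
noncomputable def hitP {d : ℕ} (S : Finset (V d)) (x : V d) : PMF (V d) :=
  lw Pinf (seqHit S x) (measurable_seqHit S x)

theorem hitP_of_notMem {d : ℕ} (S : Finset (V d)) (x : V d) (hx : x ∉ S) :
    hitP S x = PMF.pure x := by
  apply lw_const
  exact Eventually.of_forall fun u => seqHit_of_notMem S x u hx

theorem hitP_support {d : ℕ} (hd : 0 < d) (S : Finset (V d)) (x z : V d)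
    (hz : z ∈ (hitP S x).support) : z ∉ S := by
  intro hzS
  apply (PMF.mem_support_iff _ _).1 hz
  rw [hitP, lw_apply]
  apply measure_mono_null _ (stay_zero hd S x)
  intro u hu
  by_contra hn
  have := seqHit_stay S x u hn
  rw [show seqHit S x u = z from hu] at this
  exact this hzS

theorem hitP_step {d : ℕ} (hd : 0 < d) (S : Finset (V d)) (x : V d) (hx : x ∈ S) :
    hitP S x = (stepP d).bind (fun e => hitP S (x + e)) := by
  rw [stepP, pickP]
  unfold hitP
  rw [← lw_uncons (pick (unitVecs d)) (measurable_pick _) (fun e u => seqHit S (x + e) u)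
    (fun e => measurable_seqHit S (x + e)) (measurable_comb (fun u : ℕ → ℝ => pick (unitVecs d) (u 0))
      ((measurable_pick _).comp (measurable_pi_apply 0)) _ measurable_shift _
      (fun e => measurable_seqHit S (x + e)))]
  apply lw_congr
  have : ∀ᵐ u ∂Pinf, ¬ ∀ t, sw x u t ∈ S := by
    rw [ae_iff]; simpa using stay_zero hd S x
  filter_upwards [this] with u hu
  exact seqHit_step S x u hx hu

theorem hitP_markov {d : ℕ} (hd : 0 < d) (S S' : Finset (V d)) (hS : S ⊆ S') (x : V d) :
    hitP S' x = (hitP S x).bind (hitP S') := by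
  ext z
  refine harmonic_unique hd S (stepP d) (stepP_e0 d hd) (fun x => hitP S' x z)
    (fun x => (hitP S x).bind (hitP S') z) (fun x => PMF.coe_le_one _ _)
    (fun x => PMF.coe_le_one _ _) ?_ ?_ ?_ x
  · intro x hx
    rw [hitP_of_notMem S x hx, PMF.pure_bind]
  · intro x hx
    conv_lhs => rw [hitP_step hd S' x (hS hx), PMF.bind_apply]
  · intro x hx
    conv_lhs => rw [hitP_step hd S x hx, PMF.bind_bind, PMF.bind_apply]

noncomputable def addP {d : ℕ} (S : Finset (V d)) (x : V d) : PMF (Finset (V d)) :=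
  (hitP S x).bind (fun z => PMF.pure (insert z S))

noncomputable def uP {d : ℕ} (S : Finset (V d)) : PMF (Finset (V d)) := (pickP S).bind (addP S)

theorem measurable_coin (m k c : ℕ) : Measurable (fun u : ℝ => decide (u * ((m : ℝ) + k) ≤ c)) := by
  apply measurable_to_bool
  have : (fun u : ℝ => decide (u * ((m : ℝ) + k) ≤ c)) ⁻¹' {true} = {u : ℝ | u * ((m : ℝ) + k) ≤ c} := by
    ext u; simp
  rw [this]
  exact measurableSet_le (by fun_prop) measurable_const

noncomputable def coinP (m k c : ℕ) : PMF Bool :=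
  lw μ0 (fun u : ℝ => decide (u * ((m : ℝ) + k) ≤ c)) (measurable_coin m k c)

theorem coinP_true (m k c : ℕ) (h : c ≤ m + k) (h0 : 0 < m + k) :
    coinP m k c true = (c : ℝ≥0∞) * ((m + k : ℕ) : ℝ≥0∞)⁻¹ := by
  rw [coinP, lw_apply]
  have hp : (0 : ℝ) < (m : ℝ) + k := by exact_mod_cast h0
  have hc : (c : ℝ) ≤ (m : ℝ) + k := by exact_mod_cast h
  have h1 : {u : ℝ | decide (u * ((m : ℝ) + k) ≤ c) = true} = Set.Iic (c / ((m : ℝ) + k)) := by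
    ext u
    simp only [decide_eq_true_eq, Set.mem_ofPred_eq, Set.mem_Iic]
    rw [le_div_iff₀ hp]
  have h2 : Set.Iic ((c : ℝ) / ((m : ℝ) + k)) ∩ Set.Icc 0 1 = Set.Icc 0 (c / ((m : ℝ) + k)) := by
    have h3 : (c : ℝ) / ((m : ℝ) + k) ≤ 1 := (div_le_one hp).2 hc
    ext u
    simp only [Set.mem_inter_iff, Set.mem_Iic, Set.mem_Icc]
    constructor
    · tauto
    · rintro ⟨a, b⟩; exact ⟨b, a, b.trans h3⟩
  rw [h1, μ0, Measure.restrict_apply measurableSet_Iic, h2, Real.volume_Icc, sub_zero,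
    ENNReal.ofReal_div_of_pos hp, div_eq_mul_inv]
  congr 2
  · simp
  · rw [← Nat.cast_add, ENNReal.ofReal_natCast]

theorem coinP_zero : coinP 0 0 0 = PMF.pure true := by
  apply lw_const
  exact Eventually.of_forall fun u => by simp

theorem pick_mix {d : ℕ} {β : Type*} (m k : ℕ) (A T : Finset (V d)) (hT : T ⊆ A)
    (hA : A.card = m + k) (g : V d → PMF β) (c : PMF β) :
    (pickP A).bind (fun x => if x ∈ T ∨ A = ∅ then g x else c)
      = (coinP m k T.card).bind (fun b => if b = true then (pickP T).bind g else c) := by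
  classical
  by_cases hne : A = ∅
  · have hT' : T = ∅ := by rw [hne] at hT; exact Finset.subset_empty.1 hT
    subst hne
    subst hT'
    simp only [Finset.card_empty] at hA ⊢
    obtain ⟨rfl, rfl⟩ : m = 0 ∧ k = 0 := by omega
    rw [coinP_zero, pickP_empty, PMF.pure_bind, PMF.pure_bind]
    simp
  have hAne : A.Nonempty := Finset.nonempty_iff_ne_empty.2 hne
  have hpos : 0 < m + k := by rw [← hA]; exact Finset.card_pos.2 hAne
  have htrue := coinP_true m k T.card (hA ▸ Finset.card_le_card hT) hpos
  have ha0 : ((m + k : ℕ) : ℝ≥0∞) ≠ 0 := by exact_mod_cast hpos.ne'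
  have hat : ((m + k : ℕ) : ℝ≥0∞) ≠ ∞ := ENNReal.natCast_ne_top _
  have hfalse : coinP m k T.card false = ((A \ T).card : ℝ≥0∞) * ((m + k : ℕ) : ℝ≥0∞)⁻¹ := by
    have h1 := (coinP m k T.card).tsum_coe
    rw [tsum_fintype, Fintype.sum_bool, htrue] at h1
    have h2 : (T.card : ℝ≥0∞) * ((m + k : ℕ) : ℝ≥0∞)⁻¹ + ((A \ T).card : ℝ≥0∞) * ((m + k : ℕ) : ℝ≥0∞)⁻¹ = 1 := by
      rw [← add_mul, ← Nat.cast_add, add_comm, Finset.card_sdiff_add_card_eq_card hT, hA,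
        ENNReal.mul_inv_cancel ha0 hat]
    rw [← h2] at h1
    refine (ENNReal.add_right_inj ?_).1 h1
    exact ENNReal.mul_ne_top (ENNReal.natCast_ne_top _) (ENNReal.inv_ne_top.2 ha0)
  have hpb : ∀ (S : Finset (V d)) (hS : S.Nonempty) (f : V d → PMF β) (y : β),
      (pickP S).bind f y = (S.card : ℝ≥0∞)⁻¹ * ∑ x ∈ S, f x y := by
    intro S hS f y
    rw [PMF.bind_apply, tsum_eq_sum (s := S), Finset.mul_sum]
    · exact Finset.sum_congr rfl fun x hx => by rw [pickP_apply S x hx]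
    · intro x hx; rw [pickP_apply_not S hS x hx, zero_mul]
  ext y
  rw [hpb A hAne, PMF.bind_apply, tsum_fintype, Fintype.sum_bool, htrue, hfalse, hA]
  simp only [hne, or_false, if_true, Bool.false_eq_true, if_false]
  rw [← Finset.sum_sdiff hT]
  have s1 : ∑ x ∈ A \ T, (if x ∈ T then g x else c) y = (A \ T).card * c y := by
    rw [Finset.sum_congr rfl (g := fun _ => c y), Finset.sum_const, nsmul_eq_mul]
    intro x hx; rw [if_neg (Finset.mem_sdiff.1 hx).2]
  have s2 : ∑ x ∈ T, (if x ∈ T then g x else c) y = ∑ x ∈ T, g x y :=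
    Finset.sum_congr rfl fun x hx => by rw [if_pos hx]
  rw [s1, s2]
  by_cases hTe : T = ∅
  · subst hTe; simp; ring
  · have hTne := Finset.nonempty_iff_ne_empty.2 hTe
    rw [hpb T hTne]
    have ht0 : (T.card : ℝ≥0∞) ≠ 0 := by exact_mod_cast (Finset.card_pos.2 hTne).ne'
    have : (T.card : ℝ≥0∞) * ((m + k : ℕ) : ℝ≥0∞)⁻¹ * ((T.card : ℝ≥0∞)⁻¹ * ∑ x ∈ T, g x y)
        = (T.card * (T.card : ℝ≥0∞)⁻¹) * (((m + k : ℕ) : ℝ≥0∞)⁻¹ * ∑ x ∈ T, g x y) := by ring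
    rw [this, ENNReal.mul_inv_cancel ht0 (ENNReal.natCast_ne_top _)]
    ring

noncomputable def subP {d : ℕ} (m k : ℕ) (E : Finset (V d)) : PMF (Finset (V d)) :=
  (coinP m k E.card).bind (fun b => if b = true then uP E else PMF.pure E)

noncomputable def daP {d : ℕ} : Finset (V d) → List (V d) → PMF (Finset (V d))
  | S, [] => PMF.pure S
  | S, x :: xs => (addP S x).bind (fun S' => daP S' xs)

/-- iterating kernels -/
noncomputable def kit {α : Type*} (K : ℕ → α → PMF α) (a : α) : ℕ → PMF α
  | 0 => PMF.pure a
  | n + 1 => (kit K a n).bind (K n)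

theorem kit_succ' {α : Type*} (K : ℕ → α → PMF α) (a : α) (n : ℕ) :
    kit K a (n + 1) = (K 0 a).bind (fun b => kit (fun i => K (i + 1)) b n) := by
  induction n with
  | zero => simp [kit]
  | succ n ih =>
    rw [kit, ih, PMF.bind_bind]
    rfl

/-- simultaneous addition of one walk to two nested sets -/
noncomputable def cpl {d : ℕ} (T D : Finset (V d)) (x : V d) : PMF (Finset (V d) × Finset (V d)) :=
  (hitP T x).bind fun w => (hitP D w).bind fun v => PMF.pure (insert w T, insert v D)

theorem bind_congr_support {α β : Type*} (p : PMF α) (f g : α → PMF β)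
    (h : ∀ a ∈ p.support, f a = g a) : p.bind f = p.bind g := by
  ext b
  rw [PMF.bind_apply, PMF.bind_apply]
  refine tsum_congr fun a => ?_
  by_cases ha : p a = 0
  · simp [ha]
  · rw [h a ha]

theorem J_single {d : ℕ} (hd : 0 < d) (T : Finset (V d)) (x y : V d) :
    (addP T x).bind (fun T' => (addP T' y).bind fun D => PMF.pure (T', D))
      = (addP T y).bind (fun D => cpl T D x) := by
  simp only [addP, cpl, PMF.bind_bind, PMF.pure_bind]
  rw [PMF.bind_comm (hitP T y)]
  refine bind_congr_support _ _ _ fun w hw' => ?_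
  have hw := hitP_support hd T x w hw'
  rw [hitP_markov hd T (insert w T) (Finset.subset_insert _ _) y, PMF.bind_bind]
  refine bind_congr_support _ _ _ fun z hz => ?_
  have hzT := hitP_support hd T y z hz
  by_cases hzw : z = w
  · subst hzw
    rfl
  · rw [hitP_of_notMem (insert w T) z (by simp [hzw, hzT]), PMF.pure_bind,
      hitP_of_notMem (insert z T) w (by simp [Ne.symm hzw, hw]), PMF.pure_bind, Finset.insert_comm]

theorem cpl_snd {d : ℕ} (hd : 0 < d) (T D : Finset (V d)) (h : T ⊆ D) (x : V d) :
    (cpl T D x).bind (fun p => PMF.pure p.2) = addP D x := by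
  simp only [cpl, addP, PMF.bind_bind, PMF.pure_bind]
  rw [hitP_markov hd T D h x, PMF.bind_bind]

theorem addP_comm {d : ℕ} (hd : 0 < d) (T : Finset (V d)) (x y : V d) :
    (addP T x).bind (fun T' => addP T' y) = (addP T y).bind (fun T' => addP T' x) := by
  have h := congrArg (fun p => p.bind (fun p => PMF.pure p.2)) (J_single hd T x y)
  simp only [PMF.bind_bind, PMF.pure_bind, PMF.bind_pure] at h
  rw [h]
  simp only [addP, PMF.bind_bind, PMF.pure_bind]
  congr 1; funext z
  rw [cpl_snd hd T (insert z T) (Finset.subset_insert _ _)]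
  rfl

theorem daP_comm {d : ℕ} (hd : 0 < d) (ys : List (V d)) (T : Finset (V d)) (x : V d) :
    (addP T x).bind (fun T' => daP T' ys) = (daP T ys).bind (fun T' => addP T' x) := by
  induction ys generalizing T with
  | nil => simp [daP]
  | cons y ys ih =>
    simp only [daP]
    rw [← PMF.bind_bind, addP_comm hd T x y, PMF.bind_bind, PMF.bind_bind]
    congr 1; funext S
    exact ih S

theorem J_list {d : ℕ} (hd : 0 < d) (ys : List (V d)) (T : Finset (V d)) (x : V d) :
    (addP T x).bind (fun T' => (daP T' ys).bind fun D => PMF.pure (T', D))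
      = (daP T ys).bind (fun D => cpl T D x) := by
  cases ys with
  | nil =>
    simp only [daP, PMF.pure_bind, addP, cpl, PMF.bind_bind]
    refine bind_congr_support _ _ _ fun w hw => ?_
    rw [hitP_of_notMem _ _ (hitP_support hd T x w hw), PMF.pure_bind]
  | cons y ys =>
    have h := congrArg (fun p => p.bind (fun p : Finset (V d) × Finset (V d) =>
      (daP p.2 ys).bind fun D => PMF.pure (p.1, D))) (J_single hd T x y)
    simp only [PMF.bind_bind, PMF.pure_bind] at h
    simp only [daP, PMF.bind_bind]
    rw [h]
    congr 1; funext D1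
    simp only [cpl, PMF.bind_bind, PMF.pure_bind]
    rw [PMF.bind_comm (daP D1 ys)]
    congr 1; funext w
    have h2 := congrArg (fun p => p.bind fun D => PMF.pure (insert w T, D)) (daP_comm hd ys D1 w)
    simp only [addP, PMF.bind_bind, PMF.pure_bind] at h2
    exact h2

theorem daP_disjoint {d : ℕ} (ys : List (V d)) (S : Finset (V d)) (hn : ys.Nodup)
    (hdj : ∀ y ∈ ys, y ∉ S) : daP S ys = PMF.pure (S ∪ ys.toFinset) := by
  induction ys generalizing S with
  | nil => simp [daP]
  | cons y ys ih =>
    rw [daP, addP, hitP_of_notMem _ _ (hdj y (by simp)), PMF.pure_bind, PMF.pure_bind, ih]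
    · congr 1; ext z; simp
    · exact (List.nodup_cons.1 hn).2
    · intro z hz
      rw [Finset.mem_insert, not_or]
      refine ⟨?_, hdj z (by simp [hz])⟩
      rintro rfl
      exact (List.nodup_cons.1 hn).1 hz

abbrev Tr (d : ℕ) := Finset (V d) × Finset (V d) × Finset (V d)

/-- the coupled step for triples `(A, T, D)` -/
noncomputable def stepK {d : ℕ} (p : Tr d) : PMF (Tr d) :=
  (pickP p.1).bind fun x =>
    if x ∈ p.2.1 ∨ p.1 = ∅ then
      (hitP p.2.1 x).bind fun w => (hitP p.2.2 w).bind fun v => (hitP p.1 v).bind fun u =>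
        PMF.pure (insert u p.1, insert w p.2.1, insert v p.2.2)
    else (addP p.1 x).bind fun A' => PMF.pure (A', p.2)

theorem stepK_fst {d : ℕ} (hd : 0 < d) (p : Tr d) (h1 : p.2.1 ⊆ p.2.2) (h2 : p.2.2 ⊆ p.1) :
    (stepK p).bind (fun q => PMF.pure q.1) = uP p.1 := by
  simp only [stepK, uP, PMF.bind_bind]
  congr 1; funext x
  split_ifs
  · simp only [PMF.bind_bind, PMF.pure_bind, addP]
    rw [hitP_markov hd p.2.1 p.1 (h1.trans h2) x, PMF.bind_bind]
    congr 1; funext w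
    rw [hitP_markov hd p.2.2 p.1 h2 w, PMF.bind_bind]
  · simp only [PMF.bind_bind, PMF.pure_bind, PMF.bind_pure]

noncomputable def mixK {d : ℕ} (m k : ℕ) (p : Finset (V d) × Finset (V d)) :
    PMF (Finset (V d) × Finset (V d)) :=
  (coinP m k p.1.card).bind (fun b => if b = true then (pickP p.1).bind (cpl p.1 p.2) else PMF.pure p)

theorem stepK_snd {d : ℕ} (p : Tr d) (m k : ℕ) (h1 : p.2.1 ⊆ p.2.2)
    (h2 : p.2.2 ⊆ p.1) (hc : p.1.card = m + k) :
    (stepK p).bind (fun q => PMF.pure q.2) = mixK m k p.2 := by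
  rw [mixK, ← pick_mix m k p.1 p.2.1 (h1.trans h2) hc]
  simp only [stepK, PMF.bind_bind]
  congr 1; funext x
  split_ifs
  · simp only [PMF.bind_bind, PMF.pure_bind, cpl, PMF.bind_const]
  · simp only [PMF.bind_bind, PMF.pure_bind, PMF.bind_const]

theorem stepK_support {d : ℕ} (hd : 0 < d) (p q : Tr d) (N : ℕ) (h1 : p.2.1 ⊆ p.2.2)
    (h2 : p.2.2 ⊆ p.1) (hc : p.1.card = N) (hq : q ∈ (stepK p).support) :
    q.2.1 ⊆ q.2.2 ∧ q.2.2 ⊆ q.1 ∧ q.1.card = N + 1 := by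
  rw [stepK, PMF.mem_support_bind_iff] at hq
  obtain ⟨x, -, hq⟩ := hq
  have nest : ∀ (S S' : Finset (V d)) (w v : V d), S ⊆ S' → v ∈ (hitP S' w).support →
      insert w S ⊆ insert v S' := by
    intro S S' w v hS hv
    by_cases hw : w ∈ S'
    · intro z hz
      rcases Finset.mem_insert.1 hz with rfl | hz
      · exact Finset.mem_insert_of_mem hw
      · exact Finset.mem_insert_of_mem (hS hz)
    · rw [hitP_of_notMem _ _ hw] at hv
      simp only [PMF.support_pure, Set.mem_singleton_iff] at hv
      subst hv
      exact Finset.insert_subset_insert _ hS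
  split_ifs at hq
  · simp only [PMF.mem_support_bind_iff, PMF.support_pure, Set.mem_singleton_iff] at hq
    obtain ⟨w, hw, v, hv, u, hu, rfl⟩ := hq
    refine ⟨nest _ _ _ _ h1 hv, nest _ _ _ _ h2 hu, ?_⟩
    rw [Finset.card_insert_of_notMem (hitP_support hd _ _ _ hu), hc]
  · simp only [addP, PMF.bind_bind, PMF.pure_bind, PMF.mem_support_bind_iff, PMF.support_pure,
      Set.mem_singleton_iff] at hq
    obtain ⟨u, hu, rfl⟩ := hq
    refine ⟨h1, h2.trans (Finset.subset_insert _ _), ?_⟩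
    rw [Finset.card_insert_of_notMem (hitP_support hd _ _ _ hu), hc]

theorem main_coupling {d : ℕ} (hd : 0 < d) (E F : Finset (V d)) (hEF : E ⊆ F) (n : ℕ) :
    ∃ r : PMF (Tr d), r.bind (fun q => PMF.pure q.1) = kit (fun _ => uP) F n ∧
      r.bind (fun q => PMF.pure q.2) = (kit (subP F.card) E n).bind
        (fun T => (daP T (F \ E).toList).bind fun D => PMF.pure (T, D)) ∧
      ∀ q ∈ r.support, q.2.1 ⊆ q.2.2 ∧ q.2.2 ⊆ q.1 ∧ q.1.card = F.card + n := by
  induction n with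
  | zero =>
    refine ⟨PMF.pure (F, E, F), ?_, ?_, ?_⟩
    · simp [kit]
    · simp only [kit, PMF.pure_bind]
      rw [daP_disjoint _ _ (Finset.nodup_toList _), PMF.pure_bind]
      · rw [Finset.toList_toFinset, Finset.union_sdiff_of_subset hEF]
      · intro y hy
        exact (Finset.mem_sdiff.1 (Finset.mem_toList.1 hy)).2
    · intro q hq
      simp only [PMF.support_pure, Set.mem_singleton_iff] at hq
      subst hq
      exact ⟨hEF, subset_rfl, rfl⟩
  | succ n ih =>
    obtain ⟨r, hr1, hr2, hr3⟩ := ih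
    refine ⟨r.bind stepK, ?_, ?_, ?_⟩
    · rw [kit, ← hr1, PMF.bind_bind, PMF.bind_bind]
      refine bind_congr_support _ _ _ fun q hq => ?_
      obtain ⟨a, b, c⟩ := hr3 q hq
      rw [stepK_fst hd q a b, PMF.pure_bind]
    · have e1 : (r.bind stepK).bind (fun q => PMF.pure q.2) =
          (r.bind (fun q => PMF.pure q.2)).bind (mixK F.card n) := by
        rw [PMF.bind_bind, PMF.bind_bind]
        refine bind_congr_support _ _ _ fun q hq => ?_
        obtain ⟨a, b, c⟩ := hr3 q hq
        rw [stepK_snd q F.card n a b c, PMF.pure_bind]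
      rw [e1, hr2, kit, PMF.bind_bind, PMF.bind_bind]
      congr 1; funext T
      simp only [PMF.bind_bind, PMF.pure_bind, mixK, subP]
      rw [PMF.bind_comm]
      congr 1; funext b
      cases b with
      | false => simp
      | true =>
        simp only [if_true, uP, PMF.bind_bind]
        rw [PMF.bind_comm]
        congr 1; funext x
        exact (J_list hd _ T x).symm
    · intro q hq
      rw [PMF.mem_support_bind_iff] at hq
      obtain ⟨p, hp, hq⟩ := hq
      obtain ⟨a, b, c⟩ := hr3 p hp
      exact stepK_support hd p q _ a b c hq

theorem measurable_hitPt {d : ℕ} (S : Finset (V d)) (x : V d) : Measurable (hitPt S x) :=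
  (measurable_seqHit S x).comp measurable_uSlice'

theorem measurable_addPt {d : ℕ} (S : Finset (V d)) (x : V d) : Measurable (addPt S x) :=
  (measurable_of_countable (fun z : V d => insert z S)).comp (measurable_hitPt S x)

theorem lw_addPt {d : ℕ} (S : Finset (V d)) (x : V d) :
    lw μ0 (addPt S x) (measurable_addPt S x) = addP S x := by
  have h : lw μ0 (hitPt S x) (measurable_hitPt S x) = hitP S x :=
    lw_slice (seqHit S x) (measurable_seqHit S x) (measurable_hitPt S x)
  have h2 := lw_map μ0 (hitPt S x) (measurable_hitPt S x) (fun z => insert z S)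
  rw [h] at h2
  exact h2.symm

theorem measurable_uStep {d : ℕ} (S : Finset (V d)) : Measurable (uStep S) :=
  measurable_comb (fun ω => pick S (uSlice ω 0)) ((measurable_pick S).comp (measurable_uSlice 0)) _
    (measurable_uSlice 1) (addPt S) (measurable_addPt S)

theorem lw_uStep {d : ℕ} (S : Finset (V d)) :
    lw μ0 (uStep S) (measurable_uStep S) = uP S := by
  have h := lw_two (pick S) (measurable_pick S) (addPt S) (measurable_addPt S) (measurable_uStep S)
  simp only [lw_addPt] at h
  exact h

theorem subStep_eq {d : ℕ} (m k : ℕ) (E : Finset (V d)) :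
    subStep m k E = fun ω => (fun (b : Bool) (v : ℝ) => if b = true then uStep E v else E)
      ((fun u : ℝ => decide (u * ((m : ℝ) + k) ≤ E.card)) (uSlice ω 0)) (uSlice ω 1) := by
  funext ω
  simp [subStep]

theorem measurable_ite_step {d : ℕ} (E : Finset (V d)) (b : Bool) :
    Measurable (fun v : ℝ => if b = true then uStep E v else E) := by
  cases b
  · exact measurable_const
  · exact measurable_uStep E

theorem measurable_subStep {d : ℕ} (m k : ℕ) (E : Finset (V d)) : Measurable (subStep m k E) := by
  rw [subStep_eq]
  exact measurable_comb (fun ω => (fun u : ℝ => decide (u * ((m : ℝ) + k) ≤ E.card)) (uSlice ω 0))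
    ((measurable_coin m k E.card).comp (measurable_uSlice 0)) _ (measurable_uSlice 1)
    (fun (b : Bool) (v : ℝ) => if b = true then uStep E v else E) (measurable_ite_step E)

theorem lw_subStep {d : ℕ} (m k : ℕ) (E : Finset (V d)) :
    lw μ0 (subStep m k E) (measurable_subStep m k E) = subP m k E := by
  have hm := measurable_subStep m k E
  rw [subStep_eq] at hm
  have h := lw_two _ (measurable_coin m k E.card)
    (fun (b : Bool) (v : ℝ) => if b = true then uStep E v else E) (measurable_ite_step E) hm
  have h' : lw μ0 (subStep m k E) (measurable_subStep m k E) = _ :=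
    (lw_congr _ _ _ _ hm (by rw [subStep_eq])).trans h
  rw [h', subP, coinP]
  congr 1; funext b
  cases b
  · exact lw_const _ _ _ _ (Eventually.of_forall fun u => by simp)
  · exact lw_uStep E

theorem measurable_daFrom {d : ℕ} (xs : List (V d)) (S : Finset (V d)) :
    Measurable (daFrom S xs) := by
  induction xs generalizing S with
  | nil => exact measurable_const
  | cons x xs ih =>
    exact measurable_comb (fun ω => addPt S x (uSlice ω 0))
      ((measurable_addPt S x).comp (measurable_uSlice 0)) _ (measurable_uSlice 1)
      (fun S' => daFrom S' xs) ih

theorem lw_daFrom {d : ℕ} (xs : List (V d)) (S : Finset (V d)) :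
    lw μ0 (daFrom S xs) (measurable_daFrom xs S) = daP S xs := by
  induction xs generalizing S with
  | nil => exact lw_const _ _ _ _ (Eventually.of_forall fun u => rfl)
  | cons x xs ih =>
    have h := lw_two (addPt S x) (measurable_addPt S x) (fun S' => daFrom S' xs)
      (fun S' => measurable_daFrom xs S') (measurable_daFrom (x :: xs) S)
    simp only [ih, lw_addPt] at h
    exact h

section agg
variable {α : Type*} [Countable α] [MeasurableSpace α] [MeasurableSingletonClass α]

def agg (step : ℕ → α → ℝ → α) (a : α) (u : ℕ → ℝ) : ℕ → α
  | 0 => a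
  | k + 1 => step k (agg step a u k) (u k)

theorem agg_succ' (step : ℕ → α → ℝ → α) (a : α) (u : ℕ → ℝ) (n : ℕ) :
    agg step a u (n + 1) = agg (fun i => step (i + 1)) (step 0 a (u 0)) (fun i => u (i + 1)) n := by
  induction n with
  | zero => rfl
  | succ n ih => rw [agg, ih]; rfl

theorem measurable_agg (step : ℕ → α → ℝ → α) (h : ∀ k a, Measurable (step k a)) (a : α) (n : ℕ) :
    Measurable (fun u => agg step a u n) := by
  induction n with
  | zero => exact measurable_const
  | succ n ih => exact measurable_comb _ ih _ (measurable_pi_apply n) (step n) (h n)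

theorem lw_agg (step : ℕ → α → ℝ → α) (h : ∀ k a, Measurable (step k a)) (a : α) (n : ℕ) :
    lw Pinf (fun u => agg step a u n) (measurable_agg step h a n)
      = kit (fun k a => lw μ0 (step k a) (h k a)) a n := by
  induction n generalizing step a with
  | zero => exact lw_const _ _ _ _ (Eventually.of_forall fun u => rfl)
  | succ n ih =>
    rw [kit_succ']
    have hm := measurable_agg step h a (n + 1)
    simp only [agg_succ'] at hm
    have h2 := lw_uncons (step 0 a) (h 0 a) (fun b u => agg (fun i => step (i + 1)) b u n)
      (fun b => measurable_agg _ (fun k => h (k + 1)) b n) hm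
    refine (lw_congr _ _ _ _ hm (Eventually.of_forall fun u => agg_succ' step a u n)).trans ?_
    rw [h2]
    congr 1; funext b
    exact ih (fun i => step (i + 1)) (fun k => h (k + 1)) b

end agg

theorem uAgg_eq {d : ℕ} (S : Finset (V d)) (ω : ℝ) (n : ℕ) :
    uAggFrom S ω n = agg (fun _ => uStep) S (uSlice ω) n := by
  induction n with
  | zero => rfl
  | succ n ih => rw [uAggFrom, agg, ih]

theorem subAgg_eq {d : ℕ} (S : Finset (V d)) (m : ℕ) (ω : ℝ) (n : ℕ) :
    subAggFrom S m ω n = agg (subStep m) S (uSlice ω) n := by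
  induction n with
  | zero => rfl
  | succ n ih => rw [subAggFrom, agg, ih]

theorem uLaw_eq {d : ℕ} (S : Finset (V d)) (n : ℕ) :
    uLaw S n = (kit (fun _ => uP) S n).toMeasure := by
  have hm := measurable_agg (fun _ => uStep) (fun _ a => measurable_uStep a) S n
  have h := lw_agg (fun _ => uStep) (fun _ a => measurable_uStep a) S n
  simp only [lw_uStep] at h
  rw [← h, ← lw_slice _ _ (hm.comp measurable_uSlice'), lw_toMeasure, uLaw]
  simp only [uAgg_eq]

theorem subLaw_eq {d : ℕ} (S : Finset (V d)) (m n : ℕ) :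
    subLaw S m n = (kit (subP m) S n).toMeasure := by
  have hm := measurable_agg (subStep m) (fun k a => measurable_subStep m k a) S n
  have h := lw_agg (subStep m) (fun k a => measurable_subStep m k a) S n
  simp only [lw_subStep] at h
  rw [show kit (subP m) S n = kit (fun k a => subP m k a) S n from rfl, ← h,
    ← lw_slice _ _ (hm.comp measurable_uSlice'), lw_toMeasure, subLaw]
  simp only [subAgg_eq]

theorem toMeasure_bind' {α β : Type*} [Countable α] [MeasurableSpace α] [DiscreteMeasurableSpace α]
    [MeasurableSpace β] (p : PMF α) (f : α → PMF β) :
    p.toMeasure.bind (fun a => (f a).toMeasure) = (p.bind f).toMeasure := by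
  ext s hs
  rw [Measure.bind_apply hs (measurable_of_countable _).aemeasurable, lintegral_countable',
    PMF.toMeasure_bind_apply _ _ _ hs]
  refine tsum_congr fun a => ?_
  rw [PMF.toMeasure_apply_singleton _ _ (measurableSet_singleton a), mul_comm]

theorem dom_of_coupling {d : ℕ} (p q : PMF (Finset (V d)))
    (r : PMF (Finset (V d) × Finset (V d))) (h1 : r.bind (fun z => PMF.pure z.1) = p)
    (h2 : r.bind (fun z => PMF.pure z.2) = q) (h3 : ∀ z ∈ r.support, z.2 ⊆ z.1) :
    StochDom p.toMeasure q.toMeasure := by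
  refine ⟨r.toMeasure, inferInstance, ?_, ?_, ?_⟩
  · rw [PMF.toMeasure_map _ _ measurable_fst, ← h1]; rfl
  · rw [PMF.toMeasure_map _ _ measurable_snd, ← h2]; rfl
  · rw [PMF.toMeasure_apply_eq_one_iff _ (MeasurableSet.of_discrete)]
    exact h3

theorem uP_support_nonempty {d : ℕ} (S A : Finset (V d)) (h : A ∈ (uP S).support) : A.Nonempty := by
  simp only [uP, addP, PMF.mem_support_bind_iff, PMF.support_pure, Set.mem_singleton_iff] at h
  obtain ⟨x, -, z, -, rfl⟩ := h
  exact Finset.insert_nonempty _ _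

theorem statement5 (d : ℕ) (E F : Finset (V d)) (hEF : E ⊆ F) (n : ℕ) :
    StochDom (uLaw F n)
      ((subLaw E F.card n).bind (fun T => daLaw T (F \ E).toList)) := by
  have hda : ∀ T : Finset (V d), daLaw T (F \ E).toList = (daP T (F \ E).toList).toMeasure := by
    intro T
    rw [← lw_daFrom, lw_toMeasure]; rfl
  simp only [hda]
  rw [uLaw_eq, subLaw_eq, toMeasure_bind']
  rcases Nat.eq_zero_or_pos d with rfl | hd
  · by_cases h0 : F = ∅ ∧ n = 0
    · obtain ⟨rfl, rfl⟩ := h0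
      obtain rfl : E = ∅ := Finset.subset_empty.1 hEF
      refine dom_of_coupling _ _ (PMF.pure (∅, ∅)) ?_ ?_ ?_
      · simp [kit]
      · simp [kit, daP]
      · simp
    · have hne : ∀ A ∈ (kit (fun _ => uP) F n).support, A.Nonempty := by
        cases n with
        | zero =>
          intro A hA
          simp only [kit, PMF.support_pure, Set.mem_singleton_iff] at hA
          subst hA
          rw [Finset.nonempty_iff_ne_empty]
          intro h; exact h0 ⟨h, rfl⟩
        | succ n =>
          intro A hA
          rw [kit, PMF.mem_support_bind_iff] at hA
          obtain ⟨B, -, hA⟩ := hA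
          exact uP_support_nonempty B A hA
      refine dom_of_coupling _ _ ((kit (fun _ => uP) F n).bind fun A =>
        ((kit (subP F.card) E n).bind fun T => daP T (F \ E).toList).bind fun D =>
          PMF.pure (A, D)) ?_ ?_ ?_
      · simp only [PMF.bind_bind, PMF.pure_bind, PMF.bind_const, PMF.bind_pure]
      · simp only [PMF.bind_bind, PMF.pure_bind, PMF.bind_const, PMF.bind_pure]
      · intro z hz
        simp only [PMF.mem_support_bind_iff, PMF.support_pure, Set.mem_singleton_iff] at hz
        obtain ⟨A, hA, D, -, rfl⟩ := hz
        obtain ⟨a, ha⟩ := hne A hA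
        intro x _
        rwa [Subsingleton.elim x a]
  · obtain ⟨r, h1, h2, h3⟩ := main_coupling hd E F hEF n
    refine dom_of_coupling _ _ (r.bind fun q => PMF.pure (q.1, q.2.2)) ?_ ?_ ?_
    · rw [← h1, PMF.bind_bind]; simp only [PMF.pure_bind]
    · have h4 := congrArg (fun p => p.bind (fun z : Finset (V d) × Finset (V d) => PMF.pure z.2)) h2
      simp only [PMF.bind_bind, PMF.pure_bind, PMF.bind_pure] at h4
      rw [← h4, PMF.bind_bind]; simp only [PMF.pure_bind]
    · intro z hz
      simp only [PMF.mem_support_bind_iff, PMF.support_pure, Set.mem_singleton_iff] at hz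
      obtain ⟨q, hq, rfl⟩ := hz
      exact (h3 q hq).2.1
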